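/- (Asgeirsson's theorem, double-circle form) Let F : ℝ⁴ → ℝ be a smooth solution of ∂²F/∂ξ₁² + ∂²F/∂ξ₄² = ∂²F/∂ξ₂² + ∂²F/∂ξ₃². Then for every ξ ∈ ℝ⁴ and R₁, R₂ > 0, ∫₀^{2π}∫₀^{2π} F(ξ₁ + R₁cos θ₁, ξ₂ + R₂cos θ₂, ξ₃ + R₂sin θ₂, ξ₄ + R₁sin θ₁) dθ₁ dθ₂ = ∫₀^{2π}∫₀^{2π} F(ξ₁ + R₂cos θ₁, ξ₂ + R₁cos θ₂, ξ₃ + R₁sin θ₂, ξ₄ + R₂sin θ₁) dθ₁ dθ₂. -/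

import Mathlib

open Real
open MeasureTheory Set Filter Topology

lemma asg_hasFDerivAt_integral {E G : Type} [NormedAddCommGroup E] [NormedSpace ℝ E] [ProperSpace E]
    [NormedAddCommGroup G] [NormedSpace ℝ G]
    (f : E × ℝ → G) (hf : ContDiff ℝ 1 f) (a b : ℝ) (x₀ : E) :
    HasFDerivAt (fun x => ∫ t in a..b, f (x, t))
      (∫ t in a..b, (fderiv ℝ f (x₀, t)).comp (ContinuousLinearMap.inl ℝ E ℝ)) x₀ := by
  have hc : Continuous (fun z : E × ℝ => (fderiv ℝ f z).comp (ContinuousLinearMap.inl ℝ E ℝ)) :=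
    (hf.continuous_fderiv one_ne_zero).clm_comp continuous_const
  have hK : IsCompact (Metric.closedBall x₀ 1 ×ˢ uIcc a b) :=
    (isCompact_closedBall x₀ 1).prod isCompact_uIcc
  obtain ⟨C, hC⟩ := hK.exists_bound_of_continuousOn hc.continuousOn
  refine intervalIntegral.hasFDerivAt_integral_of_dominated_of_fderiv_le
    (F' := fun x t => (fderiv ℝ f (x, t)).comp (ContinuousLinearMap.inl ℝ E ℝ))
    (bound := fun _ => C) (Metric.closedBall_mem_nhds x₀ one_pos) ?_ ?_ ?_ ?_ ?_ ?_
  · refine Eventually.of_forall fun x => ?_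
    have : Continuous (fun t : ℝ => f (x, t)) := hf.continuous.comp (by fun_prop)
    exact this.aestronglyMeasurable
  · have : Continuous (fun t : ℝ => f (x₀, t)) := hf.continuous.comp (by fun_prop)
    exact this.intervalIntegrable _ _
  · have : Continuous (fun t : ℝ => (fderiv ℝ f (x₀, t)).comp (ContinuousLinearMap.inl ℝ E ℝ)) :=
      hc.comp (Continuous.prodMk_right x₀)
    exact this.aestronglyMeasurable
  · refine Eventually.of_forall fun t ht x hx => ?_
    exact hC (x, t) ⟨hx, uIoc_subset_uIcc ht⟩
  · exact intervalIntegrable_const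
  · refine Eventually.of_forall fun t ht x hx => ?_
    exact ((hf.differentiable one_ne_zero) (x, t)).hasFDerivAt.comp x (hasFDerivAt_prodMk_left x t)

lemma asg_contDiff_integral_nat (n : ℕ) : ∀ {E G : Type} [NormedAddCommGroup E] [NormedSpace ℝ E]
    [ProperSpace E] [NormedAddCommGroup G] [NormedSpace ℝ G]
    (f : E × ℝ → G) (_ : ContDiff ℝ (⊤ : ℕ∞) f) (a b : ℝ),
    ContDiff ℝ n (fun x => ∫ t in a..b, f (x, t)) := by
  induction n with
  | zero =>
    intro E G _ _ _ _ _ f hf a b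
    simp only [Nat.cast_zero, contDiff_zero]
    exact intervalIntegral.continuous_parametric_intervalIntegral_of_continuous'
      (f := fun x t => f (x, t)) hf.continuous a b
  | succ n ih =>
    intro E G _ _ _ _ _ f hf a b
    push_cast
    rw [contDiff_succ_iff_hasFDerivAt]
    refine ⟨_, ?_, fun x => asg_hasFDerivAt_integral f (hf.of_le (by exact_mod_cast le_top)) a b x⟩
    refine ih (fun z : E × ℝ => (fderiv ℝ f z).comp (ContinuousLinearMap.inl ℝ E ℝ)) ?_ a b
    exact (hf.fderiv_right (by simp)).clm_comp contDiff_const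

lemma asg_contDiff_integral {E G : Type} [NormedAddCommGroup E] [NormedSpace ℝ E]
    [ProperSpace E] [NormedAddCommGroup G] [NormedSpace ℝ G]
    (f : E × ℝ → G) (hf : ContDiff ℝ (⊤ : ℕ∞) f) (a b : ℝ) :
    ContDiff ℝ (⊤ : ℕ∞) (fun x => ∫ t in a..b, f (x, t)) :=
  contDiff_infty.2 fun n => asg_contDiff_integral_nat n f hf a b

noncomputable def asgDx (f : ℝ × ℝ → ℝ) : ℝ × ℝ → ℝ := fun p => deriv (fun t => f (t, p.2)) p.1
noncomputable def asgDy (f : ℝ × ℝ → ℝ) : ℝ × ℝ → ℝ := fun p => deriv (fun t => f (p.1, t)) p.2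

lemma asgDx_eq {f : ℝ × ℝ → ℝ} (hf : ContDiff ℝ (⊤ : ℕ∞) f) :
    asgDx f = fun p => fderiv ℝ f p (1, 0) := by
  funext p
  have h := (hf.differentiable (by simp) p).hasFDerivAt
  have h2 : HasDerivAt (fun t : ℝ => (t, p.2)) ((1 : ℝ), (0 : ℝ)) p.1 :=
    (hasDerivAt_id p.1).prodMk (hasDerivAt_const _ _)
  exact (h.comp_hasDerivAt p.1 h2).deriv

lemma asgDy_eq {f : ℝ × ℝ → ℝ} (hf : ContDiff ℝ (⊤ : ℕ∞) f) :
    asgDy f = fun p => fderiv ℝ f p (0, 1) := by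
  funext p
  have h := (hf.differentiable (by simp) p).hasFDerivAt
  have h2 : HasDerivAt (fun t : ℝ => (p.1, t)) ((0 : ℝ), (1 : ℝ)) p.2 :=
    (hasDerivAt_const _ _).prodMk (hasDerivAt_id p.2)
  exact (h.comp_hasDerivAt p.2 h2).deriv

lemma asgDx_smooth {f : ℝ × ℝ → ℝ} (hf : ContDiff ℝ (⊤ : ℕ∞) f) : ContDiff ℝ (⊤ : ℕ∞) (asgDx f) := by
  rw [asgDx_eq hf]
  exact (hf.fderiv_right (by simp)).clm_apply contDiff_const

lemma asgDy_smooth {f : ℝ × ℝ → ℝ} (hf : ContDiff ℝ (⊤ : ℕ∞) f) : ContDiff ℝ (⊤ : ℕ∞) (asgDy f) := by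
  rw [asgDy_eq hf]
  exact (hf.fderiv_right (by simp)).clm_apply contDiff_const

lemma asg_chain {f : ℝ × ℝ → ℝ} (hf : ContDiff ℝ (⊤ : ℕ∞) f) {u v : ℝ → ℝ} {u' v' t : ℝ}
    (hu : HasDerivAt u u' t) (hv : HasDerivAt v v' t) :
    HasDerivAt (fun t => f (u t, v t)) (asgDx f (u t, v t) * u' + asgDy f (u t, v t) * v') t := by
  have h := (hf.differentiable (by simp) (u t, v t)).hasFDerivAt
  have := h.comp_hasDerivAt t (hu.prodMk hv)
  convert! this using 1
  rw [asgDx_eq hf, asgDy_eq hf]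
  have e : ((u', v') : ℝ × ℝ) = u' • ((1 : ℝ), (0 : ℝ)) + v' • ((0 : ℝ), (1 : ℝ)) := by simp
  rw [e, map_add, map_smul, map_smul]
  simp [mul_comm]

lemma asg_symm {f : ℝ × ℝ → ℝ} (hf : ContDiff ℝ (⊤ : ℕ∞) f) (p : ℝ × ℝ) :
    asgDx (asgDy f) p = asgDy (asgDx f) p := by
  rw [asgDx_eq (asgDy_smooth hf), asgDy_eq (asgDx_smooth hf), asgDy_eq hf, asgDx_eq hf]
  have hd : DifferentiableAt ℝ (fderiv ℝ f) p :=
    (hf.fderiv_right (m := (⊤ : ℕ∞)) (by simp)).differentiable (by simp) p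
  have hs : IsSymmSndFDerivAt ℝ f p := by
    apply hf.contDiffAt.isSymmSndFDerivAt
    simp only [minSmoothness_of_isRCLikeNormedField]
    exact WithTop.coe_le_coe.2 (le_top : (2 : ℕ∞) ≤ ⊤)
  have h1 : ∀ v w : ℝ × ℝ, fderiv ℝ (fun p => fderiv ℝ f p v) p w = fderiv ℝ (fderiv ℝ f) p w v := by
    intro v w
    rw [fderiv_clm_apply hd (differentiableAt_const v)]
    simp
  simp only [h1]
  exact hs _ _

lemma asg_deriv_integral (f : ℝ × ℝ → ℝ) (hf : ContDiff ℝ (⊤ : ℕ∞) f) (a b r : ℝ) :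
    HasDerivAt (fun r => ∫ t in a..b, f (r, t)) (∫ t in a..b, asgDx f (r, t)) r := by
  have h1 : ContDiff ℝ 1 f := hf.of_le (by exact_mod_cast le_top)
  have := (asg_hasFDerivAt_integral f h1 a b r).hasDerivAt
  convert! this using 1
  have hc : Continuous (fun t : ℝ => (fderiv ℝ f (r, t)).comp (ContinuousLinearMap.inl ℝ ℝ ℝ)) :=
    ((h1.continuous_fderiv one_ne_zero).comp (Continuous.prodMk_right r)).clm_comp continuous_const
  rw [ContinuousLinearMap.intervalIntegral_apply (hc.intervalIntegrable _ _), asgDx_eq hf]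
  simp

/-- polar Laplacian averaged over a circle -/
lemma asg_circle (f : ℝ × ℝ → ℝ) (hf : ContDiff ℝ (⊤ : ℕ∞) f) (x₀ y₀ r : ℝ) :
    r * deriv (fun r => deriv (fun r => ∫ θ in (0:ℝ)..(2 * π), f (x₀ + r * cos θ, y₀ + r * sin θ)) r) r
      + deriv (fun r => ∫ θ in (0:ℝ)..(2 * π), f (x₀ + r * cos θ, y₀ + r * sin θ)) r
    = r * ∫ θ in (0:ℝ)..(2 * π), (asgDx (asgDx f) (x₀ + r * cos θ, y₀ + r * sin θ)
        + asgDy (asgDy f) (x₀ + r * cos θ, y₀ + r * sin θ)) := by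
  have hx := asgDx_smooth hf
  have hy := asgDy_smooth hf
  have hxx := asgDx_smooth hx
  have hyy := asgDy_smooth hy
  have hxy := asgDy_smooth hx
  set g : ℝ × ℝ → ℝ := fun p => f (x₀ + p.1 * cos p.2, y₀ + p.1 * sin p.2) with hg
  have hP : ContDiff ℝ (⊤ : ℕ∞) (fun p : ℝ × ℝ => (x₀ + p.1 * cos p.2, y₀ + p.1 * sin p.2)) := by
    fun_prop
  have hPc := hP.continuous
  have gs : ContDiff ℝ (⊤ : ℕ∞) g := hf.comp hP
  have hu : ∀ r θ : ℝ, HasDerivAt (fun r => x₀ + r * cos θ) (cos θ) r := fun r θ => by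
    simpa using ((hasDerivAt_id r).mul_const (cos θ)).const_add x₀
  have hv : ∀ r θ : ℝ, HasDerivAt (fun r => y₀ + r * sin θ) (sin θ) r := fun r θ => by
    simpa using ((hasDerivAt_id r).mul_const (sin θ)).const_add y₀
  have hu' : ∀ r θ : ℝ, HasDerivAt (fun θ => x₀ + r * cos θ) (-(r * sin θ)) θ := fun r θ => by
    simpa using ((hasDerivAt_cos θ).const_mul r).const_add x₀
  have hv' : ∀ r θ : ℝ, HasDerivAt (fun θ => y₀ + r * sin θ) (r * cos θ) θ := fun r θ => by
    simpa using ((hasDerivAt_sin θ).const_mul r).const_add y₀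
  have g1 : asgDx g = fun p => asgDx f (x₀ + p.1 * cos p.2, y₀ + p.1 * sin p.2) * cos p.2
      + asgDy f (x₀ + p.1 * cos p.2, y₀ + p.1 * sin p.2) * sin p.2 := by
    funext p
    exact (asg_chain hf (hu p.1 p.2) (hv p.1 p.2)).deriv
  have g1s := asgDx_smooth gs
  have g2s := asgDx_smooth g1s
  have g2 : ∀ r θ, asgDx (asgDx g) (r, θ) =
      asgDx (asgDx f) (x₀ + r * cos θ, y₀ + r * sin θ) * cos θ ^ 2
      + 2 * asgDy (asgDx f) (x₀ + r * cos θ, y₀ + r * sin θ) * cos θ * sin θ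
      + asgDy (asgDy f) (x₀ + r * cos θ, y₀ + r * sin θ) * sin θ ^ 2 := by
    intro r θ
    have := ((asg_chain hx (hu r θ) (hv r θ)).mul_const (cos θ)).add
      ((asg_chain hy (hu r θ) (hv r θ)).mul_const (sin θ))
    rw [g1]
    refine this.deriv.trans ?_
    rw [asg_symm hf]
    ring
  have d1 : (fun r => deriv (fun r => ∫ θ in (0:ℝ)..(2 * π), f (x₀ + r * cos θ, y₀ + r * sin θ)) r)
      = fun r => ∫ θ in (0:ℝ)..(2 * π), asgDx g (r, θ) := by
    funext r
    exact (asg_deriv_integral g gs _ _ r).deriv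
  have d2 : deriv (fun r => ∫ θ in (0:ℝ)..(2 * π), asgDx g (r, θ)) r
      = ∫ θ in (0:ℝ)..(2 * π), asgDx (asgDx g) (r, θ) :=
    (asg_deriv_integral (asgDx g) g1s _ _ r).deriv
  have d1' := congrFun d1 r
  rw [d1, d2, d1']
  set h : ℝ → ℝ := fun θ => asgDx f (x₀ + r * cos θ, y₀ + r * sin θ) * (- sin θ)
    + asgDy f (x₀ + r * cos θ, y₀ + r * sin θ) * cos θ with hh
  set h' : ℝ → ℝ := fun θ => r * (asgDx (asgDx f) (x₀ + r * cos θ, y₀ + r * sin θ)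
        + asgDy (asgDy f) (x₀ + r * cos θ, y₀ + r * sin θ))
        - r * asgDx (asgDx g) (r, θ) - asgDx g (r, θ) with hh'
  have hder : ∀ θ, HasDerivAt h (h' θ) θ := by
    intro θ
    have := ((asg_chain hx (hu' r θ) (hv' r θ)).mul (hasDerivAt_sin θ).neg).add
      ((asg_chain hy (hu' r θ) (hv' r θ)).mul (hasDerivAt_cos θ))
    convert! this using 1
    simp only [hh', g2, congrFun g1 (r, θ), asg_symm hf]
    have := sin_sq_add_cos_sq θ
    simp only [Pi.neg_apply]
    linear_combination (-r * (asgDx (asgDx f) (x₀ + r * cos θ, y₀ + r * sin θ)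
        + asgDy (asgDy f) (x₀ + r * cos θ, y₀ + r * sin θ))) * this
  have cr : Continuous (fun θ : ℝ => (x₀ + r * cos θ, y₀ + r * sin θ)) := by fun_prop
  have c1 : Continuous (fun θ : ℝ => asgDx (asgDx f) (x₀ + r * cos θ, y₀ + r * sin θ)
        + asgDy (asgDy f) (x₀ + r * cos θ, y₀ + r * sin θ)) :=
    (hxx.continuous.comp cr).add (hyy.continuous.comp cr)
  have c2 : Continuous (fun θ : ℝ => asgDx (asgDx g) (r, θ)) :=
    g2s.continuous.comp (Continuous.prodMk_right r)
  have c3 : Continuous (fun θ : ℝ => asgDx g (r, θ)) :=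
    g1s.continuous.comp (Continuous.prodMk_right r)
  have c12 : Continuous (fun θ : ℝ => r * (asgDx (asgDx f) (x₀ + r * cos θ, y₀ + r * sin θ)
        + asgDy (asgDy f) (x₀ + r * cos θ, y₀ + r * sin θ)) - r * asgDx (asgDx g) (r, θ)) :=
    (c1.const_mul r).sub (c2.const_mul r)
  have ch : Continuous h' := c12.sub c3
  have I := intervalIntegral.integral_eq_sub_of_hasDerivAt (a := 0) (b := 2 * π)
    (fun θ _ => hder θ) (ch.intervalIntegrable _ _)
  have I0 : h (2 * π) - h 0 = 0 := by simp [hh]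
  rw [I0] at I
  rw [hh', intervalIntegral.integral_sub (c12.intervalIntegrable _ _)
    (c3.intervalIntegrable _ _), intervalIntegral.integral_sub ((c1.const_mul r).intervalIntegrable _ _)
    ((c2.const_mul r).intervalIntegrable _ _), intervalIntegral.integral_const_mul,
    intervalIntegral.integral_const_mul] at I
  linarith

lemma asgDx_param {g : (ℝ × ℝ) × ℝ → ℝ} (hg : ContDiff ℝ (⊤ : ℕ∞) g) :
    ContDiff ℝ (⊤ : ℕ∞) (fun z : (ℝ × ℝ) × ℝ => asgDx (fun p => g (p, z.2)) z.1) := by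
  have : (fun z : (ℝ × ℝ) × ℝ => asgDx (fun p => g (p, z.2)) z.1)
      = fun z => fderiv ℝ g z (((1 : ℝ), (0 : ℝ)), (0 : ℝ)) := by
    funext z
    have h := (hg.differentiable (by simp) z).hasFDerivAt
    have h2 : HasDerivAt (fun t : ℝ => ((t, z.1.2), z.2)) (((1 : ℝ), (0 : ℝ)), (0 : ℝ)) z.1.1 :=
      ((hasDerivAt_id z.1.1).prodMk (hasDerivAt_const _ _)).prodMk (hasDerivAt_const _ _)
    exact (h.comp_hasDerivAt z.1.1 h2).deriv
  rw [this]
  exact (hg.fderiv_right (by simp)).clm_apply contDiff_const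

lemma asgDy_param {g : (ℝ × ℝ) × ℝ → ℝ} (hg : ContDiff ℝ (⊤ : ℕ∞) g) :
    ContDiff ℝ (⊤ : ℕ∞) (fun z : (ℝ × ℝ) × ℝ => asgDy (fun p => g (p, z.2)) z.1) := by
  have : (fun z : (ℝ × ℝ) × ℝ => asgDy (fun p => g (p, z.2)) z.1)
      = fun z => fderiv ℝ g z (((0 : ℝ), (1 : ℝ)), (0 : ℝ)) := by
    funext z
    have h := (hg.differentiable (by simp) z).hasFDerivAt
    have h2 : HasDerivAt (fun t : ℝ => ((z.1.1, t), z.2)) (((0 : ℝ), (1 : ℝ)), (0 : ℝ)) z.1.2 :=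
      ((hasDerivAt_const _ _).prodMk (hasDerivAt_id z.1.2)).prodMk (hasDerivAt_const _ _)
    exact (h.comp_hasDerivAt z.1.2 h2).deriv
  rw [this]
  exact (hg.fderiv_right (by simp)).clm_apply contDiff_const

lemma asgDx_integral {g : (ℝ × ℝ) × ℝ → ℝ} (hg : ContDiff ℝ (⊤ : ℕ∞) g) (a b : ℝ) :
    asgDx (fun p => ∫ t in a..b, g (p, t)) = fun p => ∫ t in a..b, asgDx (fun p => g (p, t)) p := by
  funext p
  exact (asg_deriv_integral (fun z : ℝ × ℝ => g ((z.1, p.2), z.2)) (by fun_prop) a b p.1).deriv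

lemma asgDy_integral {g : (ℝ × ℝ) × ℝ → ℝ} (hg : ContDiff ℝ (⊤ : ℕ∞) g) (a b : ℝ) :
    asgDy (fun p => ∫ t in a..b, g (p, t)) = fun p => ∫ t in a..b, asgDy (fun p => g (p, t)) p := by
  funext p
  exact (asg_deriv_integral (fun z : ℝ × ℝ => g ((p.1, z.1), z.2)) (by fun_prop) a b p.2).deriv

lemma asg_double_aux (g : (ℝ × ℝ) × ℝ → ℝ) (gs : ContDiff ℝ (⊤ : ℕ∞) g) (x₀ y₀ r : ℝ) :
    r * deriv (fun r => deriv (fun r => ∫ θ in (0:ℝ)..(2 * π), ∫ φ in (0:ℝ)..(2 * π),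
          g ((x₀ + r * cos θ, y₀ + r * sin θ), φ)) r) r
      + deriv (fun r => ∫ θ in (0:ℝ)..(2 * π), ∫ φ in (0:ℝ)..(2 * π),
          g ((x₀ + r * cos θ, y₀ + r * sin θ), φ)) r
    = r * ∫ θ in (0:ℝ)..(2 * π), ∫ φ in (0:ℝ)..(2 * π),
      (asgDx (asgDx (fun p => g (p, φ))) (x₀ + r * cos θ, y₀ + r * sin θ)
        + asgDy (asgDy (fun p => g (p, φ))) (x₀ + r * cos θ, y₀ + r * sin θ)) := by
  have h := asg_circle (fun p => ∫ φ in (0:ℝ)..(2 * π), g (p, φ))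
    (asg_contDiff_integral g gs _ _) x₀ y₀ r
  rw [h]
  have hx := asgDx_param gs
  have hy := asgDy_param gs
  have ex := asgDx_integral gs 0 (2 * π)
  have ey := asgDy_integral gs 0 (2 * π)
  have exx := asgDx_integral hx 0 (2 * π)
  have eyy := asgDy_integral hy 0 (2 * π)
  have hxx := asgDx_param hx
  have hyy := asgDy_param hy
  simp only at exx eyy hxx hyy
  rw [ex, ey, exx, eyy]
  congr 1
  refine intervalIntegral.integral_congr fun θ _ => ?_
  have cx := hxx.continuous.comp (Continuous.prodMk_right (x₀ + r * cos θ, y₀ + r * sin θ))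
  have cy := hyy.continuous.comp (Continuous.prodMk_right (x₀ + r * cos θ, y₀ + r * sin θ))
  exact (intervalIntegral.integral_add (cx.intervalIntegrable _ _) (cy.intervalIntegrable _ _)).symm

lemma asg_cont (g : (ℝ × ℝ) × ℝ → ℝ) (gs : ContDiff ℝ (⊤ : ℕ∞) g) (a b s : ℝ) :
    Continuous (fun y : ℝ × ℝ =>
      asgDx (asgDx (fun p => g (p, y.1))) (a + s * cos y.2, b + s * sin y.2)
      + asgDy (asgDy (fun p => g (p, y.1))) (a + s * cos y.2, b + s * sin y.2)) := by
  have c1 := (asgDx_param (asgDx_param gs)).continuous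
  have c2 := (asgDy_param (asgDy_param gs)).continuous
  simp only at c1 c2
  have cc : Continuous fun y : ℝ × ℝ => ((a + s * cos y.2, b + s * sin y.2), y.1) := by fun_prop
  exact (c1.comp cc).add (c2.comp cc)

lemma asg_energy (D : ℝ × ℝ → ℝ) (hD : ContDiff ℝ (⊤ : ℕ∞) D) (hdiag : ∀ r, D (r, r) = 0)
    (hpde : ∀ r s, r * s * asgDx (asgDx D) (r, s) + s * asgDx D (r, s)
      = r * s * asgDy (asgDy D) (r, s) + r * asgDy D (r, s))
    (r s : ℝ) (hs : 0 < s) (hsr : s ≤ r) : D (r, s) = 0 := by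
  have hp := asgDx_smooth hD
  have hq := asgDy_smooth hD
  have hsum : ∀ r, asgDx D (r, r) + asgDy D (r, r) = 0 := by
    intro r
    have h1 := asg_chain hD (hasDerivAt_id r) (hasDerivAt_id r)
    have h2 : HasDerivAt (fun t : ℝ => D (id t, id t)) 0 r := by
      simp only [id, hdiag]
      exact hasDerivAt_const _ _
    have := h1.unique h2
    simpa using this
  set k : ℝ × ℝ → ℝ := fun z => z.1 ^ 2 * z.2 *
    ((asgDx D (z.1, z.1 * z.2) ^ 2 + asgDy D (z.1, z.1 * z.2) ^ 2) / 2) with hk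
  have ks : ContDiff ℝ (⊤ : ℕ∞) k := by fun_prop
  have hE : ∀ r, HasDerivAt (fun r => ∫ u in (0:ℝ)..1, k (r, u)) (∫ u in (0:ℝ)..1, asgDx k (r, u)) r :=
    fun r => asg_deriv_integral k ks 0 1 r
  have hneg : ∀ r, 0 < r → (∫ u in (0:ℝ)..1, asgDx k (r, u)) ≤ 0 := by
    intro r hr
    set W : ℝ → ℝ := fun u => r * u ^ 2 * ((asgDx D (r, r * u) ^ 2 + asgDy D (r, r * u) ^ 2) / 2)
      + r * u * (asgDx D (r, r * u) * asgDy D (r, r * u)) with hW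
    have hWd : ∀ u, HasDerivAt W (asgDx k (r, u) + r * u * asgDx D (r, r * u) ^ 2) u := by
      intro u
      have e1 : HasDerivAt (fun u : ℝ => r * u) r u := by
        simpa using (hasDerivAt_id u).const_mul r
      have e2 : HasDerivAt (fun _ : ℝ => r) 0 u := hasDerivAt_const _ _
      have e3 : HasDerivAt (fun r : ℝ => r * u) u r := by
        simpa using (hasDerivAt_id r).mul_const u
      have pu := asg_chain hp e2 e1
      have qu := asg_chain hq e2 e1
      have pr := asg_chain hp (hasDerivAt_id r) e3
      have qr := asg_chain hq (hasDerivAt_id r) e3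
      have u2 : HasDerivAt (fun u : ℝ => r * u ^ 2) (r * (2 * u)) u := by
        simpa using (hasDerivAt_pow 2 u).const_mul r
      have r2 : HasDerivAt (fun r : ℝ => r ^ 2 * u) (2 * r * u) r := by
        simpa using (hasDerivAt_pow 2 r).mul_const u
      have hkd := (r2.mul (((pr.pow 2).add (qr.pow 2)).div_const 2)).deriv
      have hkd' : asgDx k (r, u) = _ := hkd
      have hw := (u2.mul (((pu.pow 2).add (qu.pow 2)).div_const 2)).add (e1.mul (pu.mul qu))
      convert! hw using 1
      rw [hkd']
      have P := hpde r (r * u)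
      have P' : r * u * asgDx (asgDx D) (r, r * u) + u * asgDx D (r, r * u)
        = r * u * asgDy (asgDy D) (r, r * u) + asgDy D (r, r * u) := by
        apply mul_left_cancel₀ hr.ne'
        linear_combination P
      simp only [Pi.add_apply, Pi.mul_apply, Pi.pow_apply, id, asg_symm hD]
      push_cast
      linear_combination (r * asgDx D (r, r * u)) * P'
    have cd : Continuous fun u : ℝ => asgDx k (r, u) :=
      (asgDx_smooth ks).continuous.comp (Continuous.prodMk_right r)
    have cp : Continuous fun u : ℝ => r * u * asgDx D (r, r * u) ^ 2 := by
      have := hp.continuous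
      fun_prop
    have I := intervalIntegral.integral_eq_sub_of_hasDerivAt (a := 0) (b := 1)
      (fun u _ => hWd u) ((cd.add cp).intervalIntegrable _ _)
    rw [intervalIntegral.integral_add (cd.intervalIntegrable _ _) (cp.intervalIntegrable _ _)] at I
    have W0 : W 0 = 0 := by simp [hW]
    have W1 : W 1 = 0 := by
      simp only [hW, mul_one, one_pow]
      linear_combination (r / 2 * (asgDx D (r, r) + asgDy D (r, r))) * hsum r
    have J : 0 ≤ ∫ u in (0:ℝ)..1, r * u * asgDx D (r, r * u) ^ 2 := by
      apply intervalIntegral.integral_nonneg zero_le_one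
      intro u hu
      have := hu.1
      positivity
    linarith
  have hr : 0 < r := hs.trans_le hsr
  have hanti : AntitoneOn (fun r => ∫ u in (0:ℝ)..1, k (r, u)) (Ici 0) := by
    apply antitoneOn_of_deriv_nonpos (convex_Ici 0)
    · exact fun x _ => (hE x).continuousAt.continuousWithinAt
    · exact fun x _ => (hE x).differentiableAt.differentiableWithinAt
    · intro x hx
      rw [interior_Ici] at hx
      rw [(hE x).deriv]
      exact hneg x hx
  have hle : (∫ u in (0:ℝ)..1, k (r, u)) ≤ 0 := by
    have := hanti (mem_Ici.2 le_rfl) (mem_Ici.2 hr.le) hr.le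
    simpa [hk] using this
  have hk0 : ∀ u ∈ Icc (0:ℝ) 1, k (r, u) ≤ 0 := by
    by_contra! hcon
    obtain ⟨c, hc, hcp⟩ := hcon
    have ck : Continuous fun u : ℝ => k (r, u) := ks.continuous.comp (Continuous.prodMk_right r)
    have := intervalIntegral.integral_pos zero_lt_one ck.continuousOn
      (fun u hu => by
        have := hu.1.le
        simp only [hk]
        positivity) ⟨c, hc, hcp⟩
    linarith
  have hq0 : ∀ t ∈ Icc s r, asgDy D (r, t) = 0 := by
    intro t ht
    have ht0 : 0 < t := hs.trans_le ht.1
    have := hk0 (t / r) ⟨by positivity, (div_le_one hr).2 ht.2⟩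
    simp only [hk] at this
    rw [mul_div_cancel₀ t hr.ne'] at this
    have c : 0 < r ^ 2 * (t / r) := by positivity
    have := nonpos_of_mul_nonpos_right this c
    have h1 := sq_nonneg (asgDx D (r, t))
    have h2 := sq_nonneg (asgDy D (r, t))
    have : asgDy D (r, t) ^ 2 = 0 := by linarith
    exact pow_eq_zero_iff (two_ne_zero) |>.1 this
  have hder : ∀ t, HasDerivAt (fun t => D (r, t)) (asgDy D (r, t)) t := by
    intro t
    simpa using asg_chain hD (hasDerivAt_const t r) (hasDerivAt_id t)
  have cq : Continuous fun t : ℝ => asgDy D (r, t) := hq.continuous.comp (Continuous.prodMk_right r)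
  have I := intervalIntegral.integral_eq_sub_of_hasDerivAt (a := s) (b := r)
      (fun u _ => hder u) (cq.intervalIntegrable _ _)
  have Z : (∫ t in s..r, asgDy D (r, t)) = 0 := by
    rw [intervalIntegral.integral_congr (g := fun _ => (0:ℝ))]
    · simp
    · intro t ht
      rw [uIcc_of_le hsr] at ht
      exact hq0 t ht
  rw [Z, hdiag] at I
  linarith

set_option maxHeartbeats 1000000 in
theorem asgeirsson_double_circle
    (F : ℝ × ℝ × ℝ × ℝ → ℝ) (hF : ContDiff ℝ (⊤ : ℕ∞) F)
    (hpde : ∀ a b c d : ℝ,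
      deriv (fun t => deriv (fun s => F (s, b, c, d)) t) a
        + deriv (fun t => deriv (fun s => F (a, b, c, s)) t) d
      = deriv (fun t => deriv (fun s => F (a, s, c, d)) t) b
        + deriv (fun t => deriv (fun s => F (a, b, s, d)) t) c)
    (ξ₁ ξ₂ ξ₃ ξ₄ : ℝ) (R₁ R₂ : ℝ) (hR₁ : 0 < R₁) (hR₂ : 0 < R₂) :
    (∫ θ₁ in (0 : ℝ)..(2 * π), ∫ θ₂ in (0 : ℝ)..(2 * π),
        F (ξ₁ + R₁ * cos θ₁, ξ₂ + R₂ * cos θ₂, ξ₃ + R₂ * sin θ₂, ξ₄ + R₁ * sin θ₁))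
      = ∫ θ₁ in (0 : ℝ)..(2 * π), ∫ θ₂ in (0 : ℝ)..(2 * π),
        F (ξ₁ + R₂ * cos θ₁, ξ₂ + R₁ * cos θ₂, ξ₃ + R₁ * sin θ₂, ξ₄ + R₂ * sin θ₁) := by
  set M : ℝ × ℝ → ℝ := fun z => ∫ θ₁ in (0 : ℝ)..(2 * π), ∫ θ₂ in (0 : ℝ)..(2 * π),
        F (ξ₁ + z.1 * cos θ₁, ξ₂ + z.2 * cos θ₂, ξ₃ + z.2 * sin θ₂, ξ₄ + z.1 * sin θ₁) with hM
  have Ms : ContDiff ℝ (⊤ : ℕ∞) M := by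
    have h1 : ContDiff ℝ (⊤ : ℕ∞) (fun y : ((ℝ × ℝ) × ℝ) × ℝ =>
      F (ξ₁ + y.1.1.1 * cos y.1.2, ξ₂ + y.1.1.2 * cos y.2, ξ₃ + y.1.1.2 * sin y.2,
        ξ₄ + y.1.1.1 * sin y.1.2)) := by fun_prop
    exact asg_contDiff_integral _ (asg_contDiff_integral _ h1 0 (2 * π)) 0 (2 * π)
  have swap : ∀ (f : ℝ × ℝ → ℝ), Continuous f →
      (∫ θ₁ in (0 : ℝ)..(2 * π), ∫ θ₂ in (0 : ℝ)..(2 * π), f (θ₁, θ₂))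
        = ∫ θ₂ in (0 : ℝ)..(2 * π), ∫ θ₁ in (0 : ℝ)..(2 * π), f (θ₁, θ₂) := by
    intro f hf
    apply intervalIntegral_intervalIntegral_swap (F := fun x y => f (x, y))
    have : IntegrableOn f (uIcc 0 (2 * π) ×ˢ uIcc 0 (2 * π)) :=
      hf.continuousOn.integrableOn_compact (isCompact_uIcc.prod isCompact_uIcc)
    exact this.mono_set (prod_mono uIoc_subset_uIcc uIoc_subset_uIcc)
  set Lp : ℝ × ℝ → ℝ := fun z => ∫ θ₁ in (0 : ℝ)..(2 * π), ∫ θ₂ in (0 : ℝ)..(2 * π),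
    (asgDx (asgDx (fun p => F (p.1, ξ₂ + z.2 * cos θ₂, ξ₃ + z.2 * sin θ₂, p.2)))
        (ξ₁ + z.1 * cos θ₁, ξ₄ + z.1 * sin θ₁)
      + asgDy (asgDy (fun p => F (p.1, ξ₂ + z.2 * cos θ₂, ξ₃ + z.2 * sin θ₂, p.2)))
        (ξ₁ + z.1 * cos θ₁, ξ₄ + z.1 * sin θ₁)) with hLp
  have e1 : ∀ r s, r * asgDx (asgDx M) (r, s) + asgDx M (r, s) = r * Lp (r, s) := by
    intro r s
    exact asg_double_aux (fun z => F (z.1.1, ξ₂ + s * cos z.2, ξ₃ + s * sin z.2, z.1.2)) (by fun_prop) ξ₁ ξ₄ r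
  have e2 : ∀ r s, s * asgDy (asgDy M) (r, s) + asgDy M (r, s) = s * Lp (r, s) := by
    intro r s
    have h := asg_double_aux (fun z => F (ξ₁ + r * cos z.2, z.1.1, z.1.2, ξ₄ + r * sin z.2)) (by fun_prop) ξ₂ ξ₃ s
    have hM' : M = fun z => ∫ θ₂ in (0 : ℝ)..(2 * π), ∫ θ₁ in (0 : ℝ)..(2 * π),
        F (ξ₁ + z.1 * cos θ₁, ξ₂ + z.2 * cos θ₂, ξ₃ + z.2 * sin θ₂, ξ₄ + z.1 * sin θ₁) := by
      funext z
      have hFc := hF.continuous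
      exact swap (fun y => F (ξ₁ + z.1 * cos y.1, ξ₂ + z.2 * cos y.2, ξ₃ + z.2 * sin y.2,
        ξ₄ + z.1 * sin y.1)) (by fun_prop)
    rw [hM']
    refine h.trans ?_
    congr 1
    rw [← swap (fun y => asgDx (asgDx (fun p => F (ξ₁ + r * cos y.1, p.1, p.2, ξ₄ + r * sin y.1)))
        (ξ₂ + s * cos y.2, ξ₃ + s * sin y.2)
      + asgDy (asgDy (fun p => F (ξ₁ + r * cos y.1, p.1, p.2, ξ₄ + r * sin y.1)))
        (ξ₂ + s * cos y.2, ξ₃ + s * sin y.2))]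
    · refine intervalIntegral.integral_congr fun θ₁ _ => intervalIntegral.integral_congr fun θ₂ _ => ?_
      exact (hpde (ξ₁ + r * cos θ₁) (ξ₂ + s * cos θ₂) (ξ₃ + s * sin θ₂) (ξ₄ + r * sin θ₁)).symm
    · have gs : ContDiff ℝ (⊤ : ℕ∞) (fun z : (ℝ × ℝ) × ℝ =>
        F (ξ₁ + r * cos z.2, z.1.1, z.1.2, ξ₄ + r * sin z.2)) := by fun_prop
      exact asg_cont _ gs ξ₂ ξ₃ s
  set N : ℝ × ℝ → ℝ := fun z => M (z.2, z.1) with hN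
  have Ns : ContDiff ℝ (⊤ : ℕ∞) N := by fun_prop
  have sx : ∀ {f g : ℝ × ℝ → ℝ}, ContDiff ℝ (⊤ : ℕ∞) f → ContDiff ℝ (⊤ : ℕ∞) g →
      asgDx (fun z => f z - g z) = fun z => asgDx f z - asgDx g z := by
    intro f g hf hg
    rw [asgDx_eq hf, asgDx_eq hg, asgDx_eq (hf.sub hg)]
    funext z
    rw [fderiv_fun_sub (hf.differentiable (by simp) z) (hg.differentiable (by simp) z)]
    rfl
  have sy : ∀ {f g : ℝ × ℝ → ℝ}, ContDiff ℝ (⊤ : ℕ∞) f → ContDiff ℝ (⊤ : ℕ∞) g →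
      asgDy (fun z => f z - g z) = fun z => asgDy f z - asgDy g z := by
    intro f g hf hg
    rw [asgDy_eq hf, asgDy_eq hg, asgDy_eq (hf.sub hg)]
    funext z
    rw [fderiv_fun_sub (hf.differentiable (by simp) z) (hg.differentiable (by simp) z)]
    rfl
  have key : ∀ r s, 0 < s → s ≤ r → M (r, s) - N (r, s) = 0 := by
    intro r s hs hsr
    refine asg_energy (fun z => M z - N z) (Ms.sub Ns) (fun r => by simp [hN]) ?_ r s hs hsr
    intro r s
    rw [sx Ms Ns, sy Ms Ns, sx (asgDx_smooth Ms) (asgDx_smooth Ns),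
      sy (asgDy_smooth Ms) (asgDy_smooth Ns)]
    have n1 : s * asgDy (asgDy N) (r, s) + asgDy N (r, s) = s * Lp (s, r) := e1 s r
    have n2 : r * asgDx (asgDx N) (r, s) + asgDx N (r, s) = r * Lp (s, r) := e2 s r
    linear_combination s * e1 r s - r * e2 r s - s * n2 + r * n1
  show M (R₁, R₂) = M (R₂, R₁)
  rcases le_total R₂ R₁ with h | h
  · exact sub_eq_zero.1 (key R₁ R₂ hR₂ h)
  · exact (sub_eq_zero.1 (key R₂ R₁ hR₁ h)).symm
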